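/- There exists a Landau system (λ_n)_{n≥1} satisfying λ_n = n + o(1) as n → ∞, i.e. λ_n − n → 0. -/

import Mathlib

open MeasureTheory Filter

/-- A Landau set: `Ω(L, h) = ⋃_{|l| ≤ L} [l - h/2, l + h/2]` with `L` a positive
integer and `0 < h < 1`. -/
def IsLandauSet (Ω : Set ℝ) : Prop :=
  ∃ L : ℕ, 0 < L ∧ ∃ h : ℝ, 0 < h ∧ h < 1 ∧
    Ω = ⋃ l ∈ Finset.Icc (-(L : ℤ)) (L : ℤ), Set.Icc ((l : ℝ) - h / 2) ((l : ℝ) + h / 2)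

/-- A real sequence `(lam n)_{n ≥ 1}` is a Landau system if for every positive integer
`N` and every Landau set `Ω`, the exponential system `{t ↦ e^{2πi lam n t} : n > N}`
has dense linear span in `L²(Ω)`. -/
def IsLandauSystem (lam : ℕ → ℝ) : Prop :=
  ∀ N : ℕ, 0 < N → ∀ Ω : Set ℝ, IsLandauSet Ω →
    Dense (↑(Submodule.span ℂ
        {F : Lp ℂ 2 (volume.restrict Ω) |
          ∃ n : ℕ, N < n ∧ ⇑F =ᵐ[volume.restrict Ω]
            fun t : ℝ => Complex.exp (2 * Real.pi * Complex.I * lam n * t)}) :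
      Set (Lp ℂ 2 (volume.restrict Ω)))


lemma key_poly (h : ℝ) (h0 : 0 < h) (h1 : h < 1) : ∃ φ : Polynomial ℂ, φ.eval 0 = 1 ∧
    ∃ ρ : ℝ, 0 ≤ ρ ∧ ρ < 1 ∧ ∀ x : ℝ, |x| ≤ h / 2 →
      ‖φ.eval (Complex.exp (2 * Real.pi * Complex.I * x))‖ ≤ ρ := by
  have hc0 : -1 < Real.cos (Real.pi * h) := by
    rw [← Real.cos_pi]
    have hp := Real.pi_pos
    exact Real.cos_lt_cos_of_nonneg_of_le_pi (by positivity) le_rfl (by nlinarith)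
  have hc1 := Real.cos_le_one (Real.pi * h)
  set c0 := Real.cos (Real.pi * h) with hc0d
  set r : ℝ := (3 - c0) / 4 with hr
  have hr0 : 0 < r := by linarith
  have hr1 : r < 1 := by linarith
  set κ : ℝ := (c0 + r) / 8 with hκ
  have hκ0 : 0 < κ := by linarith
  obtain ⟨m, hm⟩ : ∃ m : ℕ, r ^ m < κ * (1 - r) :=
    exists_pow_lt_of_lt_one (by apply mul_pos hκ0; linarith) hr1
  set B : ℝ := 2 / (1 - r) with hB
  have hB0 : 0 < B := by apply div_pos <;> linarith
  set c : ℝ := κ / B ^ 2 with hc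
  set q : Polynomial ℂ := Polynomial.X * ∑ k ∈ Finset.range m, (-(Polynomial.C (r : ℂ)) * Polynomial.X) ^ k with hq
  have hx : ∀ x : ℝ, |x| ≤ h / 2 → 
      κ ≤ (q.eval (Complex.exp (2 * Real.pi * Complex.I * x))).re ∧
      ‖q.eval (Complex.exp (2 * Real.pi * Complex.I * x))‖ ≤ B := by
    intro x hx
    have hcos : c0 ≤ Real.cos (2 * Real.pi * x) := by
      rw [← Real.cos_abs (2 * Real.pi * x), hc0d]
      have hp := Real.pi_pos
      apply Real.cos_le_cos_of_nonneg_of_le_pi (abs_nonneg _) (by nlinarith)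
      rw [abs_mul, abs_of_pos (by positivity)]
      nlinarith
    set z := Complex.exp (2 * Real.pi * Complex.I * x) with hz
    have hz' : z = Complex.exp ((2 * Real.pi * x : ℝ) * Complex.I) := by
      rw [hz]; congr 1; push_cast; ring
    have hzn : ‖z‖ = 1 := by rw [hz']; exact Complex.norm_exp_ofReal_mul_I _
    have hzre : z.re = Real.cos (2 * Real.pi * x) := by rw [hz', Complex.exp_ofReal_mul_I_re]
    have hw : 1 - r ≤ ‖1 + r * z‖ := by
      have := norm_sub_le_norm_add (1 : ℂ) (r * z)
      rw [norm_mul, hzn, norm_one, Complex.norm_real, Real.norm_eq_abs, abs_of_pos hr0] at this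
      linarith
    have hw2 : ‖1 + r * z‖ ≤ 2 := by
      have := norm_add_le (1 : ℂ) (r * z)
      rw [norm_mul, hzn, norm_one, Complex.norm_real, Real.norm_eq_abs, abs_of_pos hr0] at this
      linarith
    have hwne : (1 + r * z) ≠ 0 := by
      intro h0; rw [h0, norm_zero] at hw; linarith
    have hqz : q.eval z = z / (1 + r * z) - z * (-r * z) ^ m / (1 + r * z) := by
      have := geom_sum_mul_neg (-(r : ℂ) * z) m
      simp only [hq, Polynomial.eval_mul, Polynomial.eval_X, Polynomial.eval_finsetSum,
        Polynomial.eval_pow, Polynomial.eval_neg, Polynomial.eval_C]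
      rw [← sub_div, eq_div_iff hwne]
      linear_combination z * this
    have hE : ‖z * (-r * z) ^ m / (1 + r * z)‖ ≤ κ := by
      rw [norm_div, norm_mul, norm_pow, norm_mul, norm_neg, hzn, Complex.norm_real, Real.norm_eq_abs,
        abs_of_pos hr0, div_le_iff₀ (by linarith)]
      simp only [mul_one, one_mul]
      nlinarith
    have hE2 : ‖z * (-r * z) ^ m / (1 + r * z)‖ ≤ 1 / (1 - r) := by
      rw [norm_div, norm_mul, norm_pow, norm_mul, norm_neg, hzn, Complex.norm_real, Real.norm_eq_abs,
        abs_of_pos hr0]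
      simp only [mul_one, one_mul]
      exact div_le_div₀ (by norm_num) (pow_le_one₀ hr0.le hr1.le) (by linarith) hw
    have hD : ‖z / (1 + r * z)‖ ≤ 1 / (1 - r) := by
      rw [norm_div, hzn]
      exact div_le_div₀ (by norm_num) le_rfl (by linarith) hw
    constructor
    · have h1 := (abs_le.1 ((Complex.abs_re_le_norm _).trans hE)).2
      have hsq : z.re ^ 2 + z.im ^ 2 = 1 := by
        have := Complex.sq_norm z
        rw [hzn, Complex.normSq_apply] at this; nlinarith
      have h2 : (z / (1 + r * z)).re = (z.re + r) / ‖1 + r * z‖ ^ 2 := by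
        rw [Complex.div_re, Complex.sq_norm, ← add_div]
        congr 1
        simp
        linear_combination r * hsq
      have h3 : 2 * κ ≤ (z / (1 + r * z)).re := by
        rw [h2, hzre, le_div_iff₀ (by have : 0 < ‖1 + r * z‖ := by linarith
                                      positivity)]
        have : ‖1 + r * z‖ ^ 2 ≤ 4 := by nlinarith [norm_nonneg (1 + r * z)]
        nlinarith
      rw [hqz, Complex.sub_re]
      linarith
    · rw [hqz]
      refine (norm_sub_le _ _).trans ?_
      rw [hB, show 2 / (1 - r) = 1 / (1 - r) + 1 / (1 - r) by ring]
      linarith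
  refine ⟨1 - Polynomial.C (c : ℂ) * q, by simp [hq], Real.sqrt (1 - κ ^ 2 / B ^ 2), Real.sqrt_nonneg _, ?_, ?_⟩
  · rw [Real.sqrt_lt' one_pos]
    have : 0 < κ ^ 2 / B ^ 2 := by positivity
    linarith
  · intro x hx'
    obtain ⟨ha, hb⟩ := hx x hx'
    apply Real.le_sqrt_of_sq_le
    simp only [Polynomial.eval_sub, Polynomial.eval_one, Polynomial.eval_mul, Polynomial.eval_C]
    generalize q.eval (Complex.exp (2 * Real.pi * Complex.I * x)) = w at ha hb
    have h1 : ‖1 - (c : ℂ) * w‖ ^ 2 = 1 - 2 * c * w.re + c ^ 2 * ‖w‖ ^ 2 := by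
      rw [Complex.sq_norm, Complex.sq_norm, Complex.normSq_apply, Complex.normSq_apply]
      simp; ring
    have hcp : 0 < c := by positivity
    have h2 : ‖w‖ ^ 2 ≤ B ^ 2 := by gcongr
    have h3 : c * B ^ 2 = κ := by rw [hc]; field_simp
    have h4 : κ ^ 2 / B ^ 2 = c * κ := by rw [hc]; field_simp
    rw [h1, h4]
    nlinarith [mul_le_mul_of_nonneg_left ha hcp.le, mul_le_mul_of_nonneg_left h2 (sq_nonneg c)]

lemma arc_approx (h : ℝ) (h0 : 0 < h) (h1 : h < 1) (N : ℕ) (ε : ℝ) (hε : 0 < ε) :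
    ∃ M : ℕ, N < M ∧ ∃ c : ℕ → ℂ, ∀ x : ℝ, |x| ≤ h / 2 →
      ‖1 - ∑ n ∈ Finset.Ioc N M, c n * Complex.exp (2 * Real.pi * Complex.I * n * x)‖ ≤ ε := by
  obtain ⟨φ, hφ0, ρ, hρ0, hρ1, hφ⟩ := key_poly h h0 h1
  obtain ⟨η, hη, hηε⟩ : ∃ η > 0, ∀ w : ℂ, dist w 1 < η → dist (w ^ (N + 1)) (1 ^ (N + 1)) < ε :=
    Metric.continuousAt_iff.1 (by fun_prop : ContinuousAt (fun w : ℂ => w ^ (N + 1)) 1) ε hε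
  obtain ⟨m, hm⟩ := exists_pow_lt_of_lt_one hη hρ1
  set p := (1 - φ ^ m) ^ (N + 1) with hp
  have hdvd : Polynomial.X ^ (N + 1) ∣ p := by
    apply pow_dvd_pow_of_dvd
    rw [Polynomial.X_dvd_iff, Polynomial.coeff_zero_eq_eval_zero]
    simp [hφ0]
  rw [Polynomial.X_pow_dvd_iff] at hdvd
  refine ⟨p.natDegree + N + 1, by omega, p.coeff, fun x hx => ?_⟩
  have hev : ∑ n ∈ Finset.Ioc N (p.natDegree + N + 1),
      p.coeff n * Complex.exp (2 * Real.pi * Complex.I * n * x)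
      = p.eval (Complex.exp (2 * Real.pi * Complex.I * x)) := by
    rw [Polynomial.eval_eq_sum_range' (n := p.natDegree + N + 2) (by omega)]
    rw [← Finset.sum_subset (s₁ := Finset.Ioc N (p.natDegree + N + 1)) (s₂ := Finset.range (p.natDegree + N + 2))]
    · apply Finset.sum_congr rfl
      intro n _
      rw [← Complex.exp_nat_mul]
      congr 2; ring
    · intro n hn
      simp at hn ⊢; omega
    · intro n hn hn'
      simp only [Finset.mem_range, Finset.mem_Ioc] at hn hn'
      rw [hdvd n (by omega), zero_mul]
  rw [hev, ← dist_eq_norm, dist_comm]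
  have := hηε (1 - φ.eval (Complex.exp (2 * Real.pi * Complex.I * x)) ^ m) (by
    rw [dist_eq_norm, sub_sub_cancel_left, norm_neg, norm_pow]
    exact lt_of_le_of_lt (pow_le_pow_left₀ (norm_nonneg _) (hφ x hx) m) hm)
  rw [one_pow] at this
  simpa [hp] using this.le

/-- The shift used in the `k`-th block. -/
noncomputable def blockShift (k : ℕ) : ℝ := 1 / ((k : ℝ) + 1)

lemma blockShift_pos (k : ℕ) : 0 < blockShift k := by unfold blockShift; positivity

lemma blockShift_tendsto : Tendsto blockShift atTop (nhds 0) :=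
  tendsto_one_div_add_atTop_nhds_zero_nat

lemma exists_seq : ∃ lam : ℕ → ℝ, Tendsto (fun n : ℕ => lam n - (n : ℝ)) atTop (nhds 0) ∧
    ∃ b : ℕ → ℕ, StrictMono b ∧ ∀ k, ∃ c : ℕ → ℂ, 
      ∀ (l : ℤ) (t : ℝ), |t - l| ≤ (1 - blockShift (k + 1)) / 2 →
      ‖Complex.exp (2 * Real.pi * Complex.I * blockShift k * t) -
        ∑ n ∈ Finset.Ioc (b k) (b (k + 1)), c n * Complex.exp (2 * Real.pi * Complex.I * lam n * t)‖
          ≤ blockShift k ^ k := by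
  have hA : ∀ N k : ℕ, ∃ M : ℕ, N < M ∧ ∃ c : ℕ → ℂ, ∀ x : ℝ, |x| ≤ (1 - blockShift (k + 1)) / 2 →
      ‖1 - ∑ n ∈ Finset.Ioc N M, c n * Complex.exp (2 * Real.pi * Complex.I * n * x)‖
        ≤ blockShift k ^ k := by
    intro N k
    refine arc_approx _ ?_ ?_ N _ (pow_pos (blockShift_pos k) k)
    · have : blockShift (k + 1) < 1 := by
        unfold blockShift
        rw [div_lt_one (by positivity)]; push_cast; linarith [(Nat.cast_nonneg k : (0:ℝ) ≤ k)]
      linarith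
    · linarith [blockShift_pos (k + 1)]
  choose M hM c hc using hA
  set b : ℕ → ℕ := fun k => Nat.rec 0 (fun k N => M N k) k with hb
  have hbs : ∀ k, b (k + 1) = M (b k) k := fun k => rfl
  have hbm : StrictMono b := strictMono_nat_of_lt_succ fun k => by rw [hbs]; exact hM _ _
  set kk : ℕ → ℕ := fun n => Nat.findGreatest (fun k => b k < n) n with hkk
  refine ⟨fun n => n + blockShift (kk n), ?_, b, hbm, fun k => ⟨c (b k) k, fun l t ht => ?_⟩⟩
  · simp only [add_sub_cancel_left]
    refine blockShift_tendsto.comp (tendsto_atTop.2 fun K => ?_)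
    filter_upwards [eventually_gt_atTop (b K)] with n hn
    exact Nat.le_findGreatest ((hbm.le_apply).trans hn.le) hn
  · have hk : ∀ n ∈ Finset.Ioc (b k) (b (k + 1)), kk n = k := by
      intro n hn
      rw [Finset.mem_Ioc] at hn
      rw [hkk]
      simp only
      rw [Nat.findGreatest_eq_iff]
      refine ⟨(hbm.le_apply).trans hn.1.le, fun _ => hn.1, fun j hj _ h' => ?_⟩
      have := hbm.monotone (show k + 1 ≤ j from hj)
      omega
    have h1 := hc (b k) k (t - l) ht
    rw [← hbs] at h1
    refine le_trans (le_of_eq ?_) h1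
    have hu : ‖Complex.exp (2 * Real.pi * Complex.I * blockShift k * t)‖ = 1 := by
      rw [show 2 * Real.pi * Complex.I * blockShift k * t = ((2 * Real.pi * blockShift k * t : ℝ) : ℂ) * Complex.I by
        push_cast; ring]
      exact Complex.norm_exp_ofReal_mul_I _
    rw [← one_mul ‖1 - _‖, ← hu, ← norm_mul, mul_sub, mul_one, Finset.mul_sum]
    congr 2
    apply Finset.sum_congr rfl
    intro n hn
    beta_reduce
    rw [hk n hn, mul_left_comm, ← Complex.exp_add]
    congr 1
    rw [Complex.exp_eq_exp_iff_exists_int]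
    refine ⟨n * l, ?_⟩
    push_cast
    ring

lemma entire_transform (s : Set ℝ) (T : ℝ) (hs : ∀ t ∈ s, |t| ≤ T) (hsm : MeasurableSet s) (f : ℝ → ℂ)
    (hf : Integrable f (volume.restrict s)) :
    Differentiable ℂ (fun w : ℂ => ∫ t in s, f t * Complex.exp (2 * Real.pi * Complex.I * w * t)) := by
  intro w
  refine (hasDerivAt_integral_of_dominated_loc_of_deriv_le 
    (F := fun w (t : ℝ) => f t * Complex.exp (2 * Real.pi * Complex.I * w * t))
    (F' := fun w (t : ℝ) => f t * (Complex.exp (2 * Real.pi * Complex.I * w * t) * (2 * Real.pi * Complex.I * t)))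
    (bound := fun t => ‖f t‖ * (Real.exp (2 * Real.pi * (‖w‖ + 1) * T) * (2 * Real.pi * T)))
    (μ := volume.restrict s) (x₀ := w) (s := Metric.ball w 1)
    (Metric.ball_mem_nhds w one_pos) ?_ ?_ ?_ ?_ ?_ ?_).2.differentiableAt
  · refine Eventually.of_forall fun x => hf.1.mul (by fun_prop)
  · refine hf.mul_bdd (c := Real.exp (2 * Real.pi * ‖w‖ * T)) (by fun_prop) ?_
    filter_upwards [ae_restrict_mem hsm] with t ht
    rw [Complex.norm_exp]
    refine Real.exp_le_exp.2 ((Complex.re_le_norm _).trans ?_)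
    simp only [norm_mul, Complex.norm_real, Complex.norm_I, Complex.norm_ofNat, Real.norm_eq_abs,
      abs_of_pos Real.pi_pos, mul_one]
    have := hs t ht
    gcongr
  · exact hf.1.mul (by fun_prop)
  · filter_upwards [ae_restrict_mem hsm] with t ht x hx
    have hT := hs t ht
    have hT0 : 0 ≤ T := (abs_nonneg t).trans hT
    have hxn : ‖x‖ ≤ ‖w‖ + 1 := by
      have := norm_sub_norm_le x w
      rw [Metric.mem_ball, dist_eq_norm] at hx
      linarith
    have hpi := Real.pi_pos
    have e1 : ‖Complex.exp (2 * Real.pi * Complex.I * x * t)‖ ≤ Real.exp (2 * Real.pi * (‖w‖ + 1) * T) := by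
      rw [Complex.norm_exp]
      refine Real.exp_le_exp.2 ((Complex.re_le_norm _).trans ?_)
      simp only [norm_mul, Complex.norm_real, Complex.norm_I, Complex.norm_ofNat, Real.norm_eq_abs,
        abs_of_pos Real.pi_pos, mul_one]
      gcongr
    have e2 : ‖(2 * Real.pi * Complex.I * t : ℂ)‖ ≤ 2 * Real.pi * T := by
      simp only [norm_mul, Complex.norm_real, Complex.norm_I, Complex.norm_ofNat, Real.norm_eq_abs,
        abs_of_pos Real.pi_pos, mul_one]
      gcongr
    rw [norm_mul, norm_mul]
    gcongr
  · exact hf.norm.mul_const _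
  · refine Eventually.of_forall fun t x _ => ?_
    apply HasDerivAt.const_mul
    apply HasDerivAt.cexp
    have := ((hasDerivAt_id x).const_mul (2 * Real.pi * Complex.I : ℂ)).mul_const (t : ℂ)
    rw [mul_one] at this
    exact this

lemma entire_zero (Φ : ℂ → ℂ) (hΦ : Differentiable ℂ Φ) (C : ℝ)
    (h : ∀ᶠ k : ℕ in atTop, ‖Φ (blockShift k)‖ ≤ C * blockShift k ^ k) : Φ = 0 := by
  have han : AnalyticOnNhd ℂ Φ Set.univ := fun z _ => hΦ.analyticAt z
  have ht : Tendsto (fun k => (blockShift k : ℂ)) atTop (nhds 0) := by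
    have := (Complex.continuous_ofReal.tendsto 0).comp blockShift_tendsto
    rw [Complex.ofReal_zero] at this
    exact this
  by_cases hz : ∀ᶠ z in nhds (0 : ℂ), Φ z = 0
  · exact han.eq_of_eventuallyEq (g := 0) (fun z _ => analyticAt_const) hz
  exfalso
  obtain ⟨m, g, hg, hg0, hgm⟩ := (hΦ.analyticAt 0).exists_eventuallyEq_pow_smul_nonzero_iff.2 hz
  apply hg0
  have h1 : Tendsto (fun k => g (blockShift k)) atTop (nhds (g 0)) := hg.continuousAt.tendsto.comp ht
  refine tendsto_nhds_unique h1 ?_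
  refine squeeze_zero_norm' (a := fun k => |C| * blockShift k) ?_ (by simpa using blockShift_tendsto.const_mul |C|)
  filter_upwards [h, ht.eventually hgm, eventually_gt_atTop m] with k hk1 hk2 hk3
  have hp := blockShift_pos k
  have hle : blockShift k ≤ 1 := by
    unfold blockShift
    rw [div_le_one (by positivity)]; linarith [(Nat.cast_nonneg k : (0:ℝ) ≤ k)]
  rw [hk2, sub_zero, norm_smul, norm_pow, Complex.norm_real, Real.norm_eq_abs, abs_of_pos hp] at hk1
  have h3 : blockShift k ^ k ≤ blockShift k ^ m * blockShift k := by
    rw [← pow_succ]; exact pow_le_pow_of_le_one hp.le hle hk3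
  have h4 : 0 < blockShift k ^ m := by positivity
  refine le_of_mul_le_mul_left (a := blockShift k ^ m) ?_ h4
  calc _ ≤ C * blockShift k ^ k := hk1
    _ ≤ |C| * blockShift k ^ k := by gcongr; exact le_abs_self C
    _ ≤ |C| * (blockShift k ^ m * blockShift k) := by gcongr
    _ = _ := by ring

lemma transform_injective (s : Set ℝ) (T : ℝ) (hT : 0 < T) (hs : ∀ t ∈ s, |t| < T) (hsm : MeasurableSet s)
    (f : ℝ → ℂ) (hf : MemLp f 2 (volume.restrict s))
    (h : ∀ w : ℝ, ∫ t in s, f t * Complex.exp (2 * Real.pi * Complex.I * w * t) = 0) :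
    f =ᵐ[volume.restrict s] 0 := by
  have hab : -T < T := by linarith
  have hsub : s ⊆ Set.Ioc (-T) T := fun t ht => by
    have := abs_lt.1 (hs t ht); exact ⟨this.1, this.2.le⟩
  set F := s.indicator f with hF
  have hF2 : MemLp F 2 volume := (memLp_indicator_iff_restrict hsm).2 hf
  have hc : ∀ n, fourierCoeffOn hab F n = 0 := by
    intro n
    rw [fourierCoeffOn_eq_integral, intervalIntegral.integral_of_le hab.le]
    have : ∫ x in Set.Ioc (-T) T, fourier (-n) (x : AddCircle (T - -T)) • F x = 
      ∫ t in s, f t * Complex.exp (2 * Real.pi * Complex.I * ((-n / (2 * T) : ℝ) : ℂ) * t) := by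
      rw [← integral_indicator hsm, ← integral_indicator measurableSet_Ioc]
      congr 1
      ext t
      by_cases ht : t ∈ s
      · rw [Set.indicator_of_mem ht, Set.indicator_of_mem (hsub ht), hF, Set.indicator_of_mem ht,
          fourier_coe_apply, smul_eq_mul, mul_comm]
        congr 2
        push_cast
        have : (T : ℂ) ≠ 0 := by exact_mod_cast hT.ne'
        field_simp
        ring_nf
        try field_simp
      · simp [hF, ht]
    rw [this, h, smul_zero]
  have hsum := hasSum_sq_fourierCoeffOn hab (f := F) (hF2.restrict _)
  simp only [hc, norm_zero, ne_eq, OfNat.ofNat_ne_zero, not_false_eq_true, zero_pow] at hsum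
  have h0 := hsum.unique hasSum_zero
  rw [smul_eq_mul, mul_eq_zero, or_iff_right (by rw [inv_eq_zero]; linarith),
    intervalIntegral.integral_of_le hab.le] at h0
  have hF3 := hF2.restrict (Set.Ioc (-T) T)
  rw [integral_eq_zero_iff_of_nonneg (fun x => by positivity)
    ((memLp_two_iff_integrable_sq_norm hF3.1).1 hF3)] at h0
  have h1 := ae_restrict_of_ae_restrict_of_subset hsub h0
  filter_upwards [h1, ae_restrict_mem hsm] with t ht hts
  simpa [hF, hts] using ht

/-- **Existence of a Landau system with `lam n = n + o(1)`.** -/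
theorem exists_landau_system_near_integers :
    ∃ lam : ℕ → ℝ, IsLandauSystem lam ∧
      Tendsto (fun n : ℕ => lam n - (n : ℝ)) atTop (nhds 0) := by
  obtain ⟨lam, hlam, b, hb, hc⟩ := exists_seq
  refine ⟨lam, ?_, hlam⟩
  rintro N - Ω ⟨L, -, h, h0, h1, hΩ⟩
  have hmem : ∀ t ∈ Ω, ∃ l : ℤ, |t - l| ≤ h / 2 ∧ |l| ≤ L := by
    intro t ht
    rw [hΩ] at ht
    simp only [Set.mem_iUnion, Finset.mem_Icc, Set.mem_Icc] at ht
    obtain ⟨l, hl, ht⟩ := ht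
    exact ⟨l, abs_le.2 ⟨by linarith, by linarith⟩, abs_le.2 hl⟩
  have hΩm : MeasurableSet Ω := by
    rw [hΩ]
    exact Finset.measurableSet_biUnion _ fun l _ => measurableSet_Icc
  have hbd : ∀ t ∈ Ω, |t| < (L : ℝ) + 1 := by
    intro t ht
    obtain ⟨l, h2, h3⟩ := hmem t ht
    have h3' : |(l : ℝ)| ≤ L := by exact_mod_cast h3
    have := abs_sub_abs_le_abs_sub t l
    linarith
  have hfin : volume Ω < ⊤ := by
    refine (measure_mono (fun t ht => ?_)).trans_lt
      (measure_Icc_lt_top : volume (Set.Icc (-((L : ℝ) + 1)) (L + 1)) < ⊤)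
    have := abs_lt.1 (hbd t ht)
    exact ⟨this.1.le, this.2.le⟩
  have : IsFiniteMeasure (volume.restrict Ω) := ⟨by simpa using hfin⟩
  have hnorm : ∀ a t : ℝ, ‖Complex.exp (2 * Real.pi * Complex.I * a * t)‖ = 1 := by
    intro a t
    rw [show 2 * Real.pi * Complex.I * a * t = ((2 * Real.pi * a * t : ℝ) : ℂ) * Complex.I by
      push_cast; ring]
    exact Complex.norm_exp_ofReal_mul_I _
  rw [Submodule.dense_iff_topologicalClosure_eq_top, Submodule.topologicalClosure_eq_top_iff,
    Submodule.eq_bot_iff]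
  intro f hf
  set g : ℝ → ℂ := fun t => (starRingEnd ℂ) (f t) with hg
  have hg2 : MemLp g 2 (volume.restrict Ω) := (Lp.memLp f).star
  have hg1 : Integrable g (volume.restrict Ω) := hg2.integrable (by norm_num)
  have horth : ∀ n, N < n → ∫ t in Ω, g t * Complex.exp (2 * Real.pi * Complex.I * lam n * t) = 0 := by
    intro n hn
    have hm : MemLp (fun t : ℝ => Complex.exp (2 * Real.pi * Complex.I * lam n * t)) 2
        (volume.restrict Ω) :=
      MemLp.of_bound (by fun_prop) 1 (Eventually.of_forall fun t => (hnorm _ _).le)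
    have hmemS : hm.toLp _ ∈ {F : Lp ℂ 2 (volume.restrict Ω) |
          ∃ n : ℕ, N < n ∧ ⇑F =ᵐ[volume.restrict Ω]
            fun t : ℝ => Complex.exp (2 * Real.pi * Complex.I * lam n * t)} :=
      ⟨n, hn, hm.coeFn_toLp⟩
    have := Submodule.inner_left_of_mem_orthogonal (Submodule.subset_span (R := ℂ) hmemS) hf
    rw [L2.inner_def] at this
    rw [← this]
    apply integral_congr_ae
    filter_upwards [hm.coeFn_toLp] with t ht
    rw [ht, RCLike.inner_apply, mul_comm]
  have hint : ∀ a : ℝ, Integrable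
      (fun t : ℝ => g t * Complex.exp (2 * Real.pi * Complex.I * a * t)) (volume.restrict Ω) :=
    fun a => hg1.mul_bdd (c := 1) (by fun_prop) (Eventually.of_forall fun t => (hnorm _ _).le)
  have hΦ := entire_zero _ (entire_transform Ω (L + 1) (fun t ht => (hbd t ht).le) hΩm g hg1)
    (∫ t in Ω, ‖g t‖) (by
      have e1 : ∀ᶠ k : ℕ in atTop, blockShift (k + 1) < 1 - h :=
        (blockShift_tendsto.comp (tendsto_add_atTop_nat 1)).eventually (gt_mem_nhds (by linarith))
      filter_upwards [e1, eventually_ge_atTop N] with k hk1 hk2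
      obtain ⟨c, hck⟩ := hc k
      have hsum : ∫ t in Ω, g t * Complex.exp (2 * Real.pi * Complex.I * blockShift k * t)
          = ∫ t in Ω, g t * (Complex.exp (2 * Real.pi * Complex.I * blockShift k * t) -
            ∑ n ∈ Finset.Ioc (b k) (b (k + 1)),
              c n * Complex.exp (2 * Real.pi * Complex.I * lam n * t)) := by
        simp_rw [mul_sub, Finset.mul_sum, mul_left_comm (g _)]
        rw [integral_sub (hint _) (integrable_finsetSum _ fun n _ => (hint _).const_mul _),
          integral_finsetSum _ fun n _ => (hint _).const_mul _, Finset.sum_eq_zero, sub_zero]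
        intro n hn
        rw [Finset.mem_Ioc] at hn
        have := hb.le_apply (x := k)
        rw [integral_const_mul, horth n (by omega), mul_zero]
      rw [hsum, ← integral_mul_const]
      refine norm_integral_le_of_norm_le (hg1.norm.mul_const _) ?_
      filter_upwards [ae_restrict_mem hΩm] with t ht
      obtain ⟨l, hl, -⟩ := hmem t ht
      rw [norm_mul]
      gcongr
      exact hck l t (by linarith))
  have hg0 := transform_injective Ω (L + 1) (by positivity) hbd hΩm g hg2
    (fun w => congrFun hΦ (w : ℂ))
  rw [Lp.eq_zero_iff_ae_eq_zero]
  filter_upwards [hg0] with t ht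
  simpa [hg] using ht
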